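/- For each fixed a with |a| < 1, the function B(x,a) = [6(1 - |a|²|x|²) + 2(1 - x̄a)] (1 - x̄a) / |1 - x̄a|^{10} is left 𝕆-analytic in x on the open unit ball of ℝ⁸, i.e., D_x B(x,a) = 0. -/

import Mathlib

noncomputable section
open MeasureTheory Metric
open scoped Quaternion

/-- The octonions, via the Cayley–Dickson construction on the quaternions,
carrying the Euclidean (`L²`) norm. -/
abbrev Octonion : Type := WithLp 2 (ℍ[ℝ] × ℍ[ℝ])

namespace Octonion

def mk (a b : ℍ[ℝ]) : Octonion := (WithLp.equiv 2 (ℍ[ℝ] × ℍ[ℝ])).symm (a, b)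
def p1 (x : Octonion) : ℍ[ℝ] := (WithLp.equiv 2 (ℍ[ℝ] × ℍ[ℝ]) x).1
def p2 (x : Octonion) : ℍ[ℝ] := (WithLp.equiv 2 (ℍ[ℝ] × ℍ[ℝ]) x).2

instance : One Octonion := ⟨mk 1 0⟩
/-- Cayley–Dickson multiplication: `(a,b)(c,d) = (ac - d̄b, da + bc̄)`. -/
instance : Mul Octonion :=
  ⟨fun x y => mk (p1 x * p1 y - star (p2 y) * p2 x) (p2 y * p1 x + p2 x * star (p1 y))⟩

/-- Octonionic conjugation. -/
def conj (x : Octonion) : Octonion := mk (star (p1 x)) (-(p2 x))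

/-- The standard basis `e₀ = 1, e₁, …, e₇` of the octonions. -/
def e : Fin 8 → Octonion
  | 0 => mk 1 0
  | 1 => mk ⟨0,1,0,0⟩ 0
  | 2 => mk ⟨0,0,1,0⟩ 0
  | 3 => mk ⟨0,0,0,1⟩ 0
  | 4 => mk 0 1
  | 5 => mk 0 ⟨0,1,0,0⟩
  | 6 => mk 0 ⟨0,0,1,0⟩
  | 7 => mk 0 ⟨0,0,0,1⟩

/-- The real coordinates of an octonion w.r.t. the basis `e`. -/
def coord (i : Fin 8) (x : Octonion) : ℝ :=
  match i with
  | 0 => (p1 x).re | 1 => (p1 x).imI | 2 => (p1 x).imJ | 3 => (p1 x).imK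
  | 4 => (p2 x).re | 5 => (p2 x).imI | 6 => (p2 x).imJ | 7 => (p2 x).imK

/-- Partial derivative in the direction `e i`. -/
def pd (i : Fin 8) (f : Octonion → Octonion) (x : Octonion) : Octonion :=
  fderiv ℝ f x (e i)

/-- The generalized Cauchy–Riemann operator `Df = ∑ eᵢ ∂f/∂xᵢ`. -/
def D (f : Octonion → Octonion) (x : Octonion) : Octonion := ∑ i, e i * pd i f x

/-- The right-acting Cauchy–Riemann operator `fD = ∑ (∂f/∂xᵢ) eᵢ`. -/
def Dright (f : Octonion → Octonion) (x : Octonion) : Octonion := ∑ i, pd i f x * e i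

/-- The conjugate Cauchy–Riemann operator `D̄f = ∑ ēᵢ ∂f/∂xᵢ`. -/
def Dbar (f : Octonion → Octonion) (x : Octonion) : Octonion := ∑ i, conj (e i) * pd i f x

/-- The Laplacian `Δf = ∑ ∂²f/∂xᵢ²`. -/
def lap (f : Octonion → Octonion) (x : Octonion) : Octonion :=
  ∑ i, fderiv ℝ (fun y => fderiv ℝ f y (e i)) x (e i)

instance : MeasurableSpace Octonion := borel _
instance : BorelSpace Octonion := ⟨rfl⟩
instance : MeasureSpace Octonion := ⟨Measure.addHaar⟩

/-- The surface measure on the unit sphere `S⁷`. -/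
def sphereMeasure : Measure (sphere (0 : Octonion) 1) := (volume : Measure Octonion).toSphere

/-- `ω₈`, the surface area of the unit sphere in `ℝ⁸`. -/
def ω : ℝ := (sphereMeasure Set.univ).toReal

end Octonion

/-- The octonionic Bergman kernel of the unit ball. -/
def bergmanKernel (x a : Octonion) : Octonion :=
  (‖(1 : Octonion) - Octonion.conj x * a‖ ^ 10)⁻¹ •
    (((6 * (1 - ‖a‖ ^ 2 * ‖x‖ ^ 2)) • (1 : Octonion) +
        (2 : ℝ) • ((1 : Octonion) - Octonion.conj x * a)) *
      ((1 : Octonion) - Octonion.conj x * a))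

namespace Octonion

theorem ext_p {x y : Octonion} (h1 : p1 x = p1 y) (h2 : p2 x = p2 y) : x = y := by
  apply (WithLp.equiv 2 (ℍ[ℝ] × ℍ[ℝ])).injective
  exact Prod.ext h1 h2

theorem p1_mk (a b : ℍ[ℝ]) : p1 (mk a b) = a := rfl
theorem p2_mk (a b : ℍ[ℝ]) : p2 (mk a b) = b := rfl
theorem p1_add (x y : Octonion) : p1 (x + y) = p1 x + p1 y := rfl
theorem p2_add (x y : Octonion) : p2 (x + y) = p2 x + p2 y := rfl
theorem p1_sub (x y : Octonion) : p1 (x - y) = p1 x - p1 y := rfl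
theorem p2_sub (x y : Octonion) : p2 (x - y) = p2 x - p2 y := rfl
theorem p1_neg (x : Octonion) : p1 (-x) = -p1 x := rfl
theorem p2_neg (x : Octonion) : p2 (-x) = -p2 x := rfl
theorem p1_zero : p1 0 = 0 := rfl
theorem p2_zero : p2 0 = 0 := rfl
theorem p1_smul (r : ℝ) (x : Octonion) : p1 (r • x) = r • p1 x := rfl
theorem p2_smul (r : ℝ) (x : Octonion) : p2 (r • x) = r • p2 x := rfl
theorem p1_one : p1 1 = 1 := rfl
theorem p2_one : p2 1 = 0 := rfl
theorem p1_mul (x y : Octonion) : p1 (x * y) = p1 x * p1 y - star (p2 y) * p2 x := rfl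
theorem p2_mul (x y : Octonion) : p2 (x * y) = p2 y * p1 x + p2 x * star (p1 y) := rfl
theorem p1_conj (x : Octonion) : p1 (conj x) = star (p1 x) := rfl
theorem p2_conj (x : Octonion) : p2 (conj x) = -p2 x := rfl

theorem mul_add' (x y z : Octonion) : x * (y + z) = x * y + x * z := by
  apply ext_p <;> simp only [p1_add, p2_add, p1_mul, p2_mul, star_add] <;> noncomm_ring
theorem add_mul' (x y z : Octonion) : (x + y) * z = x * z + y * z := by
  apply ext_p <;> simp only [p1_add, p2_add, p1_mul, p2_mul, star_add] <;> noncomm_ring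
theorem mul_smul' (r : ℝ) (x y : Octonion) : x * (r • y) = r • (x * y) := by
  apply ext_p <;> simp [p1_mul, p2_mul, p1_smul, p2_smul, smul_sub]
theorem smul_mul' (r : ℝ) (x y : Octonion) : (r • x) * y = r • (x * y) := by
  apply ext_p <;> simp [p1_mul, p2_mul, p1_smul, p2_smul, smul_sub]
theorem mul_neg' (x y : Octonion) : x * (-y) = -(x * y) := by
  apply ext_p <;> simp only [p1_neg, p2_neg, p1_mul, p2_mul, star_neg] <;> noncomm_ring
theorem neg_mul' (x y : Octonion) : (-x) * y = -(x * y) := by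
  apply ext_p <;> simp only [p1_neg, p2_neg, p1_mul, p2_mul] <;> noncomm_ring
theorem mul_sub' (x y z : Octonion) : x * (y - z) = x * y - x * z := by
  rw [sub_eq_add_neg, mul_add', mul_neg', sub_eq_add_neg]
theorem sub_mul' (x y z : Octonion) : (x - y) * z = x * z - y * z := by
  rw [sub_eq_add_neg, add_mul', neg_mul', sub_eq_add_neg]
theorem mul_one' (x : Octonion) : x * 1 = x := by
  apply ext_p <;> simp [p1_mul, p2_mul, p1_one, p2_one]
theorem one_mul' (x : Octonion) : 1 * x = x := by
  apply ext_p <;> simp [p1_mul, p2_mul, p1_one, p2_one]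

theorem inner_eq (x y : Octonion) : inner ℝ x y =
    (p1 x).re * (p1 y).re + (p1 x).imI * (p1 y).imI + (p1 x).imJ * (p1 y).imJ
    + (p1 x).imK * (p1 y).imK + (p2 x).re * (p2 y).re + (p2 x).imI * (p2 y).imI
    + (p2 x).imJ * (p2 y).imJ + (p2 x).imK * (p2 y).imK := by
  have : inner ℝ x y = inner ℝ (p1 x) (p1 y) + inner ℝ (p2 x) (p2 y) := rfl
  rw [this, Quaternion.inner_def, Quaternion.inner_def]
  simp [Quaternion.re_mul]
  ring

theorem norm_sq_eq (x : Octonion) : ‖x‖ ^ 2 = inner ℝ x x := (real_inner_self_eq_norm_sq x).symm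

/-- Close a goal by passing to the eight real coordinates. -/
theorem ext8 {x y : Octonion} (h : ∀ i, coord i x = coord i y) : x = y := by
  apply ext_p
  · exact Quaternion.ext _ _ (h 0) (h 1) (h 2) (h 3)
  · exact Quaternion.ext _ _ (h 4) (h 5) (h 6) (h 7)

theorem conj_mul_mul (x a : Octonion) : x * (conj x * a) = (‖x‖ ^ 2) • a := by
  rw [norm_sq_eq, inner_eq]
  apply ext8
  intro i
  fin_cases i <;>
  · simp [coord, p1_mul, p2_mul, p1_conj, p2_conj, p1_smul, p2_smul, Quaternion.re_mul,
      Quaternion.imI_mul, Quaternion.imJ_mul, Quaternion.imK_mul]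
    ring

theorem mul_conj_mul (x a : Octonion) :
    a * (conj x * a) = (2 * inner ℝ a x) • a - (‖a‖ ^ 2) • x := by
  rw [norm_sq_eq, inner_eq, inner_eq]
  apply ext8
  intro i
  fin_cases i <;>
  · simp [coord, p1_mul, p2_mul, p1_conj, p2_conj, p1_smul, p2_smul, p1_sub, p2_sub,
      Quaternion.re_mul, Quaternion.imI_mul, Quaternion.imJ_mul, Quaternion.imK_mul]
    ring

theorem norm_conj_mul (x a : Octonion) :
    ‖(1 : Octonion) - conj x * a‖ ^ 2 = 1 - 2 * inner ℝ a x + ‖a‖ ^ 2 * ‖x‖ ^ 2 := by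
  rw [norm_sq_eq, norm_sq_eq, norm_sq_eq, inner_eq, inner_eq, inner_eq, inner_eq]
  simp [p1_mul, p2_mul, p1_conj, p2_conj, p1_one, p2_one, p1_sub, p2_sub,
      Quaternion.re_mul, Quaternion.imI_mul, Quaternion.imJ_mul, Quaternion.imK_mul]
  ring

theorem inner_one_conj_mul (x a : Octonion) :
    inner ℝ (1 : Octonion) (1 - conj x * a) = 1 - inner ℝ a x := by
  rw [inner_eq, inner_eq]
  simp [p1_mul, p2_mul, p1_conj, p2_conj, p1_one, p2_one, p1_sub, p2_sub, Quaternion.re_mul]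
  ring

theorem mul_self_eq (c : Octonion) :
    c * c = (2 * inner ℝ 1 c) • c - (‖c‖ ^ 2) • (1 : Octonion) := by
  rw [norm_sq_eq, inner_eq, inner_eq]
  apply ext8
  intro i
  fin_cases i <;>
  · simp [coord, p1_mul, p2_mul, p1_one, p2_one, p1_smul, p2_smul, p1_sub, p2_sub,
      Quaternion.re_mul, Quaternion.imI_mul, Quaternion.imJ_mul, Quaternion.imK_mul]
    ring

theorem sum_mul' (f : Fin 8 → Octonion) (z : Octonion) : (∑ i, f i) * z = ∑ i, f i * z := by
  simp only [Fin.sum_univ_eight, add_mul']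

theorem coord_add (j : Fin 8) (x y : Octonion) : coord j (x + y) = coord j x + coord j y := by
  fin_cases j <;> rfl

theorem coord_smul (j : Fin 8) (r : ℝ) (x : Octonion) : coord j (r • x) = r * coord j x := by
  fin_cases j <;> rfl

theorem coord_e (j i : Fin 8) : coord j (e i) = if i = j then 1 else 0 := by
  fin_cases j <;> fin_cases i <;> rfl

theorem inner_coord (x y : Octonion) : inner ℝ x y = ∑ i, coord i x * coord i y := by
  rw [inner_eq, Fin.sum_univ_eight]
  rfl

theorem inner_e (a : Octonion) (i : Fin 8) : inner ℝ a (e i) = coord i a := by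
  simp [inner_coord, coord_e, -WithLp.prod_inner_apply]

theorem sum_inner (a : Octonion) : ∑ i, (inner ℝ a (e i) : ℝ) • e i = a := by
  apply ext8
  intro j
  simp only [inner_e, Fin.sum_univ_eight, coord_add, coord_smul, coord_e]
  fin_cases j <;> simp

theorem sum_e_conj (a : Octonion) : ∑ i, e i * (conj (e i) * a) = (8 : ℝ) • a := by
  have h : ∀ i, ‖e i‖ ^ 2 = 1 := by
    intro i
    rw [norm_sq_eq, inner_e, coord_e]
    simp
  simp only [conj_mul_mul, h, one_smul]
  simp [← Nat.cast_smul_eq_nsmul ℝ]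

/-- `y ↦ ȳ a` as a linear map. -/
def conjMulLin (a : Octonion) : Octonion →ₗ[ℝ] Octonion where
  toFun y := conj y * a
  map_add' x y := by
    rw [← add_mul']
    congr 1
    apply ext_p <;> simp [p1_add, p2_add, p1_conj, p2_conj, add_comm]
  map_smul' r x := by
    rw [RingHom.id_apply, ← smul_mul']
    congr 1
    apply ext_p <;> simp [p1_smul, p2_smul, p1_conj, p2_conj]

instance : FiniteDimensional ℝ Octonion :=
  (WithLp.linearEquiv 2 ℝ (ℍ[ℝ] × ℍ[ℝ])).symm.finiteDimensional

theorem kernel_eq (y a : Octonion) : bergmanKernel y a =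
    ((1 - 2 * inner ℝ a y + ‖a‖ ^ 2 * ‖y‖ ^ 2) ^ 5)⁻¹ •
      ((10 - 6 * (‖a‖ ^ 2 * ‖y‖ ^ 2) - 4 * inner ℝ a y) • ((1 : Octonion) - conj y * a)
        - (2 * (1 - 2 * inner ℝ a y + ‖a‖ ^ 2 * ‖y‖ ^ 2)) • (1 : Octonion)) := by
  unfold bergmanKernel
  rw [show ‖(1 : Octonion) - conj y * a‖ ^ 10 = (‖(1 : Octonion) - conj y * a‖ ^ 2) ^ 5 by ring,
    add_mul', smul_mul', smul_mul', one_mul', mul_self_eq, norm_conj_mul, inner_one_conj_mul]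
  congr 1
  module

theorem sum_e_mul (a x U W : Octonion) (r : ℝ) :
    ∑ i, e i * ((inner ℝ a (e i) : ℝ) • U + (inner ℝ x (e i) : ℝ) • W + r • (conj (e i) * a))
      = a * U + x * W + (8 * r) • a := by
  have h1 : a * U = ∑ i, (inner ℝ a (e i) : ℝ) • (e i * U) := by
    conv_lhs => rw [← sum_inner a, sum_mul']
    simp only [smul_mul']
  have h2 : x * W = ∑ i, (inner ℝ x (e i) : ℝ) • (e i * W) := by
    conv_lhs => rw [← sum_inner x, sum_mul']
    simp only [smul_mul']
  have h3 : (8 * r) • a = ∑ i, r • (e i * (conj (e i) * a)) := by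
    rw [← Finset.smul_sum, sum_e_conj, smul_smul, mul_comm]
  rw [h1, h2, h3, ← Finset.sum_add_distrib, ← Finset.sum_add_distrib]
  simp only [mul_add', mul_smul']

end Octonion

open Octonion in
/-- For fixed `a` with `|a| < 1`, the octonionic Bergman kernel `B(x,a)` is left
octonionic analytic in `x` on the open unit ball. -/
theorem octonion_bergman_kernel_analytic (a : Octonion) (ha : ‖a‖ < 1)
    (x : Octonion) (hx : ‖x‖ < 1) :
    Octonion.D (fun y => bergmanKernel y a) x = 0 := by
  have hN : 1 - 2 * inner ℝ a x + ‖a‖ ^ 2 * ‖x‖ ^ 2 ≠ 0 := by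
    have h1 := real_inner_le_norm a x
    have h2 : ‖a‖ * ‖x‖ < 1 := by nlinarith [norm_nonneg a, norm_nonneg x]
    have h3 : 0 < (1 - ‖a‖ * ‖x‖) ^ 2 := by
      have : 0 < 1 - ‖a‖ * ‖x‖ := by linarith
      positivity
    nlinarith
  have ht : HasFDerivAt (fun y : Octonion => (inner ℝ a y : ℝ)) (innerSL ℝ a) x :=
    (innerSL ℝ a).hasFDerivAt
  have hs : HasFDerivAt (fun y : Octonion => ‖y‖ ^ 2) (2 • innerSL ℝ x) x :=
    (hasStrictFDerivAt_norm_sq x).hasFDerivAt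
  have hc : HasFDerivAt (fun y : Octonion => conj y * a)
      (LinearMap.toContinuousLinearMap (conjMulLin a)) x :=
    (LinearMap.toContinuousLinearMap (conjMulLin a)).hasFDerivAt
  have hNd := ((ht.const_mul 2).const_sub 1).add (hs.const_mul (‖a‖ ^ 2))
  have hPd := ((hs.const_mul (‖a‖ ^ 2)).const_mul 6 |>.const_sub 10).sub (ht.const_mul 4)
  have hinv := (hasDerivAt_inv (pow_ne_zero 5 hN)).comp_hasFDerivAt x (hNd.pow 5)
  have hB := hinv.smul ((hPd.smul (hc.const_sub 1)).sub ((hNd.const_mul 2).smul_const (1 : Octonion)))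
  have hc1 : a * (1 - conj x * a) = (1 - 2 * inner ℝ a x) • a + (‖a‖ ^ 2) • x := by
    rw [mul_sub', mul_one', mul_conj_mul]
    module
  have hc2 : x * (1 - conj x * a) = x - (‖x‖ ^ 2) • a := by
    rw [mul_sub', mul_one', conj_mul_mul]
  have hfun : (fun y => bergmanKernel y a) = _ := funext fun y => kernel_eq y a
  have hder := (congrArg (fun f => fderiv ℝ f x) hfun).trans hB.fderiv
  have key := fun h => congrArg (fun L : Octonion →L[ℝ] Octonion => L h) hder
  simp only [add_apply, sub_apply,
    neg_apply, smul_apply, ContinuousLinearMap.smulRight_apply,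
    innerSL_apply_apply, LinearMap.coe_toContinuousLinearMap', Pi.add_apply, Pi.sub_apply,
    Pi.smul_apply', Function.comp_apply] at key
  have hM : ∀ h, conjMulLin a h = conj h * a := fun _ => rfl
  simp only [hM] at key
  clear hB hder hinv hPd hNd hc hs ht hfun
  generalize hcc : (1 : Octonion) - conj x * a = c at *
  generalize htt : (inner ℝ a x : ℝ) = t at *
  generalize hAA : ‖a‖ ^ 2 = A at *
  generalize hXX : ‖x‖ ^ 2 = X at *
  generalize hNN : 1 - 2 * t + A * X = N at *
  generalize hPP : 10 - 6 * (A * X) - 4 * t = P at *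
  have key2 : ∀ h, fderiv ℝ (fun y => bergmanKernel y a) x h =
      (inner ℝ a h : ℝ) • ((N ^ 5)⁻¹ • ((-4 : ℝ) • c + (4 : ℝ) • (1 : Octonion))
        + (10 * (((N ^ 5) ^ 2)⁻¹ * N ^ 4)) • (P • c - (2 * N) • (1 : Octonion)))
      + (inner ℝ x h : ℝ) • ((N ^ 5)⁻¹ • ((-12 * A) • c - (4 * A) • (1 : Octonion))
        - (10 * A * (((N ^ 5) ^ 2)⁻¹ * N ^ 4)) • (P • c - (2 * N) • (1 : Octonion)))
      + (-((N ^ 5)⁻¹ * P)) • (conj h * a) := by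
    intro h
    rw [key]
    simp only [smul_eq_mul, nsmul_eq_mul]
    push_cast
    module
  unfold Octonion.D pd
  simp only [key2]
  rw [sum_e_mul]
  simp only [mul_add', mul_sub', mul_smul', mul_one', hc1, hc2]
  have hk : ((N ^ 5) ^ 2)⁻¹ * N ^ 4 = (N ^ 5)⁻¹ * N⁻¹ := by
    field_simp
  rw [hk]
  have hNi : N⁻¹ * N = 1 := inv_mul_cancel₀ hN
  generalize N⁻¹ = n at *
  generalize (N ^ 5)⁻¹ = m at *
  match_scalars
  · subst hPP
    subst hNN
    linear_combination (10 * m * (10 - 6 * (A * X) - 4 * t - 2)) * hNi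
  · subst hPP
    subst hNN
    linear_combination (20 * A * m) * hNi
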